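/- For every p with 1 < p ≤ 3/2 there is a constant C_p such that for every nonnegative measurable function w on ℝ³ with ‖w‖_{M^p(ℝ³)} < ∞, one has ‖w‖_F ≤ C_p ‖w‖_{M^p(ℝ³)}. -/

import Mathlib

open MeasureTheory ENNReal NNReal Real Filter
open scoped Classical

noncomputable section

abbrev E3 : Type := EuclideanSpace ℝ (Fin 3)

/-- The axis-parallel cube in `ℝ³` centered at `z` with side length `r`. -/
def cube3 (z : E3) (r : ℝ) : Set E3 := {x : E3 | ∀ i, |x i - z i| ≤ r / 2}

/-- The Kerman–Sawyer ratio for the cube `Q(z,r)`. -/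
def ksRatio (w : E3 → ℝ≥0∞) (z : E3) (r : ℝ) : ℝ≥0∞ :=
  (∫⁻ x in cube3 z r, w x)⁻¹ *
    ∫⁻ x in cube3 z r, ∫⁻ y in cube3 z r, w x * w y / edist x y

/-- The Kerman–Sawyer norm `‖w‖_F` on `ℝ³`. -/
def ksNorm (w : E3 → ℝ≥0∞) : ℝ≥0∞ :=
  ⨆ (z : E3) (r : ℝ) (_ : 0 < r), ksRatio w z r

/-- Fractional integral of order 1 on `ℝ³`: `I₁ f x = ∫ f y / |x-y|² dy`. -/
def I1 (f : E3 → ℝ≥0∞) (x : E3) : ℝ≥0∞ := ∫⁻ y, f y / (edist x y) ^ 2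

/-- Fractional integral of order 2 on `ℝ³`: `I₂ f x = ∫ f y / |x-y| dy`. -/
def I2 (f : E3 → ℝ≥0∞) (x : E3) : ℝ≥0∞ := ∫⁻ y, f y / edist x y

/-- The fundamental cell `Ω = [0, 2π)³`. -/
def Ω3 : Set E3 := {x : E3 | ∀ i, 0 ≤ x i ∧ x i < 2 * π}

/-- Periodicity with respect to the lattice `(2πℤ)³`. -/
def Periodic3 {α : Type*} (w : E3 → α) : Prop :=
  ∀ (x : E3) (n : Fin 3 → ℤ),
    w (x + (WithLp.equiv 2 (Fin 3 → ℝ)).symm (fun i => 2 * π * n i)) = w x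

/-- The Kerman–Sawyer norm on the torus. -/
def ksNormT (w : E3 → ℝ≥0∞) : ℝ≥0∞ :=
  ⨆ (z : E3) (_ : z ∈ Ω3) (r : ℝ) (_ : 0 < r) (_ : r < 4 * π), ksRatio w z r

/-- Euclidean norm of a vector in `Fin 3 → ℝ`. -/
def norm3 (v : Fin 3 → ℝ) : ℝ := Real.sqrt (∑ i, (v i) ^ 2)

/-- The character `e^{i n·x}`. -/
def ewave (n : Fin 3 → ℤ) (x : E3) : ℂ :=
  Complex.exp (Complex.I * ((∑ i, (n i : ℝ) * x i : ℝ) : ℂ))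

/-- The real quadratic form `v A vᵀ`. -/
def qA (A : Matrix (Fin 3) (Fin 3) ℝ) (v : Fin 3 → ℝ) : ℝ := ∑ i, ∑ j, v i * A i j * v j

/-- The Morrey norm `‖f‖_{M^p(ℝ³)}`. -/
def morreyNorm (p : ℝ) (w : E3 → ℝ≥0∞) : ℝ≥0∞ :=
  ⨆ (z : E3) (r : ℝ) (_ : 0 < r),
    (ENNReal.ofReal (r ^ 3)) ^ ((2 : ℝ)/3) *
      ((ENNReal.ofReal (r ^ 3))⁻¹ * ∫⁻ y in cube3 z r, (w y) ^ p) ^ ((1 : ℝ)/p)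

theorem lintegral_Ioi_rpow {a r : ℝ} (ha : a < -1) (hr : 0 < r) :
    ∫⁻ t in Set.Ioi r, ENNReal.ofReal (t ^ a) = ENNReal.ofReal (-r ^ (a + 1) / (a + 1)) := by
  rw [← integral_Ioi_rpow_of_lt ha hr,
    ofReal_integral_eq_lintegral_ofReal (integrableOn_Ioi_rpow_of_lt ha hr)]
  filter_upwards [ae_restrict_mem measurableSet_Ioi] with t ht
  exact Real.rpow_nonneg (hr.le.trans (le_of_lt ht)) _

/-- Layer-cake bound for the Newtonian potential. -/
theorem lintegral_div_edist_le (x : E3) {g : E3 → ℝ≥0∞} (hg : Measurable g) :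
    ∫⁻ y, g y / edist x y ≤
      ∫⁻ t in Set.Ioi (0 : ℝ), ENNReal.ofReal (t ^ (-2 : ℝ)) * ∫⁻ y in Metric.ball x t, g y := by
  have hS : MeasurableSet {q : ℝ × E3 | dist q.2 x < q.1} :=
    measurableSet_lt (by fun_prop) (by fun_prop)
  have h1 : ∀ t : ℝ, ENNReal.ofReal (t ^ (-2 : ℝ)) * ∫⁻ y in Metric.ball x t, g y =
      ∫⁻ y, {q : ℝ × E3 | dist q.2 x < q.1}.indicator
        (fun q => ENNReal.ofReal (q.1 ^ (-2 : ℝ)) * g q.2) (t, y) := by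
    intro t
    rw [← lintegral_const_mul _ hg, ← lintegral_indicator Metric.isOpen_ball.measurableSet]
    rfl
  simp_rw [h1]
  rw [lintegral_lintegral_swap]
  · apply lintegral_mono_ae
    filter_upwards [(Set.countable_singleton x).ae_notMem volume] with y hy
    have hd : 0 < dist y x := dist_pos.2 hy
    calc g y / edist x y = g y * ∫⁻ t in Set.Ioi (dist y x), ENNReal.ofReal (t ^ (-2 : ℝ)) := by
          rw [lintegral_Ioi_rpow (by norm_num) hd, div_eq_mul_inv, edist_dist, dist_comm,
            ← ENNReal.ofReal_inv_of_pos hd]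
          norm_num [Real.rpow_neg_one]
      _ = ∫⁻ t in Set.Ioi (dist y x), ENNReal.ofReal (t ^ (-2 : ℝ)) * g y := by
          rw [lintegral_mul_const _ (by fun_prop), mul_comm]
      _ = ∫⁻ t in Set.Ioi (0 : ℝ), (Set.Ioi (dist y x)).indicator
            (fun t => ENNReal.ofReal (t ^ (-2 : ℝ)) * g y) t := by
          rw [setLIntegral_indicator measurableSet_Ioi, Set.inter_eq_left.2]
          exact Set.Ioi_subset_Ioi hd.le
      _ ≤ _ := le_of_eq rfl
  · exact (Measurable.indicator (by fun_prop) hS).aemeasurable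

theorem setLIntegral_compl_ball_div_edist_le (x : E3) {g : E3 → ℝ≥0∞} (hg : Measurable g)
    {B : ℝ≥0∞} {τ δ : ℝ} (hτ : τ < 1) (hδ : 0 < δ)
    (h : ∀ t, 0 < t → ∫⁻ y in Metric.ball x t, g y ≤ B * ENNReal.ofReal (t ^ τ)) :
    ∫⁻ y in (Metric.ball x δ)ᶜ, g y / edist x y ≤
      B * ENNReal.ofReal (δ ^ (τ - 1) / (1 - τ)) := by
  have hm : MeasurableSet (Metric.ball x δ)ᶜ := Metric.isOpen_ball.measurableSet.compl
  calc ∫⁻ y in (Metric.ball x δ)ᶜ, g y / edist x y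
      = ∫⁻ y, (Metric.ball x δ)ᶜ.indicator g y / edist x y := by
        rw [← lintegral_indicator hm]
        congr 1 with y
        by_cases hy : y ∈ (Metric.ball x δ)ᶜ <;> simp only [hy, Set.indicator_of_mem,
          Set.indicator_of_notMem, not_false_eq_true, ENNReal.zero_div]
    _ ≤ ∫⁻ t in Set.Ioi (0 : ℝ), ENNReal.ofReal (t ^ (-2 : ℝ)) *
          ∫⁻ y in Metric.ball x t, (Metric.ball x δ)ᶜ.indicator g y :=
        lintegral_div_edist_le x (hg.indicator hm)
    _ ≤ ∫⁻ t in Set.Ioi (0 : ℝ), (Set.Ioi δ).indicator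
          (fun t => B * ENNReal.ofReal (t ^ (τ - 2))) t := by
        refine setLIntegral_mono' measurableSet_Ioi fun t (ht : 0 < t) => ?_
        rcases le_or_gt t δ with h1 | h1
        · rw [setLIntegral_indicator hm, ← Set.sdiff_eq_compl_inter,
            Set.sdiff_eq_empty.2 (Metric.ball_subset_ball h1)]
          simp
        · rw [Set.indicator_of_mem (Set.mem_Ioi.2 h1)]
          calc _ ≤ ENNReal.ofReal (t ^ (-2 : ℝ)) * (B * ENNReal.ofReal (t ^ τ)) := by
                gcongr
                exact (lintegral_mono (Set.indicator_le_self _ _)).trans (h t ht)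
            _ = _ := by
                rw [mul_left_comm, ← ENNReal.ofReal_mul (by positivity), ← Real.rpow_add ht]
                ring_nf
    _ = _ := by
        rw [setLIntegral_indicator measurableSet_Ioi,
          Set.inter_eq_left.2 (Set.Ioi_subset_Ioi hδ.le),
          lintegral_const_mul _ (by fun_prop), lintegral_Ioi_rpow (by linarith) hδ]
        congr 2
        rw [show τ - 2 + 1 = τ - 1 by ring, show τ - 1 = -(1 - τ) by ring, neg_div_neg_eq]

theorem volume_ball_E3 (x : E3) {t : ℝ} (ht : 0 ≤ t) :
    volume (Metric.ball x t) = ENNReal.ofReal (t ^ 3) * volume (Metric.ball (0 : E3) 1) := by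
  rw [Measure.addHaar_ball _ _ ht]
  simp

theorem setLIntegral_ball_inv_edist_le (x z : E3) {δ : ℝ} (hδ : 0 < δ) :
    ∫⁻ y in Metric.ball x δ, 1 / edist z y ≤
      2 * volume (Metric.ball (0 : E3) 1) * ENNReal.ofReal (δ ^ 2) := by
  set V := volume (Metric.ball (0 : E3) 1) with hV
  have hm : MeasurableSet (Metric.ball x δ) := Metric.isOpen_ball.measurableSet
  calc ∫⁻ y in Metric.ball x δ, 1 / edist z y
      = ∫⁻ y, (Metric.ball x δ).indicator 1 y / edist z y := by
        rw [← lintegral_indicator hm]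
        congr 1 with y
        by_cases hy : y ∈ Metric.ball x δ <;> simp only [hy, Set.indicator_of_mem,
          Set.indicator_of_notMem, not_false_eq_true, ENNReal.zero_div, Pi.one_apply]
    _ ≤ ∫⁻ t in Set.Ioi (0 : ℝ), ENNReal.ofReal (t ^ (-2 : ℝ)) *
          ∫⁻ y in Metric.ball z t, (Metric.ball x δ).indicator 1 y :=
        lintegral_div_edist_le z (measurable_one.indicator hm)
    _ ≤ ∫⁻ t in Set.Ioc 0 δ ∪ Set.Ioi δ, ENNReal.ofReal (t ^ (-2 : ℝ)) *
          ∫⁻ y in Metric.ball z t, (Metric.ball x δ).indicator 1 y := by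
        rw [Set.Ioc_union_Ioi_eq_Ioi hδ.le]
    _ ≤ _ := lintegral_union_le _ _ _
    _ ≤ (∫⁻ t in Set.Ioc 0 δ, V * ENNReal.ofReal δ) +
          ∫⁻ t in Set.Ioi δ, V * ENNReal.ofReal (δ ^ 3) * ENNReal.ofReal (t ^ (-2 : ℝ)) := by
        gcongr ?_ + ?_
        · refine setLIntegral_mono' measurableSet_Ioc fun t ht => ?_
          have ht0 : 0 < t := ht.1
          calc _ ≤ ENNReal.ofReal (t ^ (-2 : ℝ)) * volume (Metric.ball z t) := by
                gcongr
                rw [← setLIntegral_one]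
                exact lintegral_mono (Set.indicator_le_self _ _)
            _ = V * ENNReal.ofReal t := by
                rw [volume_ball_E3 z ht0.le, ← mul_assoc, ← ENNReal.ofReal_mul (by positivity),
                  mul_comm, ← hV, ← Real.rpow_natCast t 3, ← Real.rpow_add ht0]
                norm_num
            _ ≤ _ := by gcongr; exact ht.2
        · refine lintegral_mono fun t => ?_
          rw [mul_comm]
          gcongr
          rw [setLIntegral_indicator hm]
          calc _ ≤ volume (Metric.ball x δ) := by
                simp only [Pi.one_apply, setLIntegral_one]
                exact measure_mono Set.inter_subset_left
            _ = _ := by rw [volume_ball_E3 x hδ.le, mul_comm]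
    _ = _ := by
        rw [lintegral_const, lintegral_const_mul _ (by fun_prop), lintegral_Ioi_rpow (by norm_num) hδ,
          Measure.restrict_apply_univ, Real.volume_Ioc, mul_assoc, mul_assoc,
          ← ENNReal.ofReal_mul hδ.le, ← ENNReal.ofReal_mul (by positivity), mul_assoc, two_mul]
        congr 3
        · ring
        · norm_num [Real.rpow_neg_one]
          field_simp

theorem measurable_I2 {f : E3 → ℝ≥0∞} (hf : Measurable f) : Measurable (I2 f) := by
  unfold I2
  exact Measurable.lintegral_prod_right' (f := fun q : E3 × E3 => f q.2 / edist q.1 q.2)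
    (by fun_prop)

theorem ENNReal.inv_mul_inv_le_of_le_add {R a b : ℝ≥0∞} (h : R ≤ a + b) (h0 : R ≠ 0)
    (ht : R ≠ ⊤) (ha : a ≠ ⊤) (hb : b ≠ ⊤) : a⁻¹ * b⁻¹ ≤ R⁻¹ * (a⁻¹ + b⁻¹) := by
  have hR : R⁻¹ ≠ 0 := ENNReal.inv_ne_zero.2 ht
  rcases eq_or_ne a 0 with rfl | ha0
  · simp [ENNReal.mul_top hR]
  rcases eq_or_ne b 0 with rfl | hb0
  · simp [ENNReal.mul_top hR]
  calc a⁻¹ * b⁻¹ = R⁻¹ * (R * (a⁻¹ * b⁻¹)) := by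
        rw [← mul_assoc, ENNReal.inv_mul_cancel h0 ht, one_mul]
    _ ≤ R⁻¹ * ((a + b) * (a⁻¹ * b⁻¹)) := by gcongr
    _ = R⁻¹ * ((a * a⁻¹) * b⁻¹ + (b * b⁻¹) * a⁻¹) := by ring
    _ = _ := by
        rw [ENNReal.mul_inv_cancel ha0 ha, ENNReal.mul_inv_cancel hb0 hb, one_mul, one_mul,
          add_comm]

theorem setLIntegral_ball_I2_div_edist_le (x : E3) {f : E3 → ℝ≥0∞} (hf : Measurable f)
    {δ : ℝ} (hδ : 0 < δ) :
    ∫⁻ y in Metric.ball x δ, I2 f y / edist x y ≤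
      4 * volume (Metric.ball (0 : E3) 1) * ENNReal.ofReal (δ ^ 2) * I2 f x := by
  set V := volume (Metric.ball (0 : E3) 1) with hV
  calc ∫⁻ y in Metric.ball x δ, I2 f y / edist x y
      = ∫⁻ y in Metric.ball x δ, ∫⁻ z, f z * ((edist y z)⁻¹ * (edist x y)⁻¹) := by
        refine lintegral_congr fun y => ?_
        rw [I2, div_eq_mul_inv, ← lintegral_mul_const _ (by fun_prop)]
        simp_rw [div_eq_mul_inv, mul_assoc]
    _ = ∫⁻ z, ∫⁻ y in Metric.ball x δ, f z * ((edist y z)⁻¹ * (edist x y)⁻¹) :=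
        lintegral_lintegral_swap (Measurable.aemeasurable (by fun_prop))
    _ ≤ ∫⁻ z, 4 * V * ENNReal.ofReal (δ ^ 2) * (f z / edist x z) := by
        apply lintegral_mono_ae
        filter_upwards [(Set.countable_singleton x).ae_notMem volume] with z hz
        have hxz : edist x z ≠ 0 := by
          rw [Ne, edist_eq_zero]
          exact fun h => hz h.symm
        calc ∫⁻ y in Metric.ball x δ, f z * ((edist y z)⁻¹ * (edist x y)⁻¹)
            ≤ ∫⁻ y in Metric.ball x δ,
                f z * ((edist x z)⁻¹ * (1 / edist z y + 1 / edist x y)) := by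
              refine lintegral_mono fun y => mul_le_mul_right ?_ _
              rw [one_div, one_div, edist_comm z y]
              exact ENNReal.inv_mul_inv_le_of_le_add
                (by rw [add_comm]; exact edist_triangle x y z) hxz (edist_ne_top _ _)
                (edist_ne_top _ _) (edist_ne_top _ _)
          _ = f z * ((edist x z)⁻¹ * ((∫⁻ y in Metric.ball x δ, 1 / edist z y) +
                ∫⁻ y in Metric.ball x δ, 1 / edist x y)) := by
              rw [lintegral_const_mul _ (by fun_prop), lintegral_const_mul _ (by fun_prop),
                lintegral_add_left (by fun_prop)]
          _ ≤ f z * ((edist x z)⁻¹ * (2 * V * ENNReal.ofReal (δ ^ 2) +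
                2 * V * ENNReal.ofReal (δ ^ 2))) := by
              gcongr <;> exact setLIntegral_ball_inv_edist_le _ _ hδ
          _ = _ := by rw [div_eq_mul_inv]; ring
    _ = _ := by rw [lintegral_const_mul _ (by fun_prop), I2]

theorem setLIntegral_ball_I2_le (x : E3) {f : E3 → ℝ≥0∞} (hf : Measurable f) {p : ℝ}
    (hp : 1 < p) {A : ℝ≥0∞}
    (h : ∀ t, 0 < t → ∫⁻ y in Metric.ball x t, f y ≤ A * ENNReal.ofReal (t ^ (3 - 2 * p)))
    {l : ℝ} (hl : 0 < l) :
    ∫⁻ y in Metric.ball x l, I2 f y ≤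
      volume (Metric.ball (0 : E3) 1) * A *
        ENNReal.ofReal ((4 + 1 / (p - 1)) * l ^ (5 - 2 * p)) := by
  set V := volume (Metric.ball (0 : E3) 1) with hV
  have hm : MeasurableSet (Metric.ball x (2 * l)) := Metric.isOpen_ball.measurableSet
  have h2l : 0 < 2 * l := by positivity
  have hp1 : 0 < p - 1 := by linarith
  calc ∫⁻ y in Metric.ball x l, I2 f y
      = ∫⁻ z, ∫⁻ y in Metric.ball x l, f z / edist y z :=
        lintegral_lintegral_swap (Measurable.aemeasurable (by fun_prop))
    _ = ∫⁻ z, f z * ∫⁻ y in Metric.ball x l, 1 / edist z y := by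
        refine lintegral_congr fun z => ?_
        rw [← lintegral_const_mul _ (by fun_prop)]
        simp_rw [edist_comm z, one_div, div_eq_mul_inv]
    _ = (∫⁻ z in Metric.ball x (2 * l), f z * ∫⁻ y in Metric.ball x l, 1 / edist z y) +
          ∫⁻ z in (Metric.ball x (2 * l))ᶜ, f z * ∫⁻ y in Metric.ball x l, 1 / edist z y :=
        (lintegral_add_compl _ hm).symm
    _ ≤ (∫⁻ z in Metric.ball x (2 * l), f z * (2 * V * ENNReal.ofReal (l ^ 2))) +
          ∫⁻ z in (Metric.ball x (2 * l))ᶜ,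
            (f z / edist x z) * (2 * V * ENNReal.ofReal (l ^ 3)) := by
        gcongr ?_ + ?_
        · gcongr with z
          exact setLIntegral_ball_inv_edist_le _ _ hl
        · refine setLIntegral_mono' hm.compl fun z hz => ?_
          rw [div_eq_mul_inv, mul_assoc]
          gcongr
          calc ∫⁻ y in Metric.ball x l, 1 / edist z y
              ≤ ∫⁻ y in Metric.ball x l, 2 * (edist x z)⁻¹ := by
                refine setLIntegral_mono' Metric.isOpen_ball.measurableSet fun y hy => ?_
                have h1 : 2 * l ≤ dist z x := not_lt.1 hz
                have h2 : dist y x < l := hy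
                have h3 := dist_triangle z y x
                have h4 : dist x z ≤ 2 * dist z y := by rw [dist_comm x z]; linarith
                rw [one_div, edist_dist z y, edist_dist x z, ENNReal.inv_le_iff_inv_le,
                  ENNReal.mul_inv (by simp) (by simp), inv_inv, mul_comm, ← div_eq_mul_inv]
                refine ENNReal.div_le_of_le_mul ?_
                calc ENNReal.ofReal (dist x z) ≤ ENNReal.ofReal (dist z y * 2) :=
                      ENNReal.ofReal_le_ofReal (by linarith)
                  _ = _ := by rw [ENNReal.ofReal_mul dist_nonneg, ENNReal.ofReal_ofNat]
            _ = _ := by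
                rw [setLIntegral_const, volume_ball_E3 x hl.le]
                ring
    _ = (∫⁻ z in Metric.ball x (2 * l), f z) * (2 * V * ENNReal.ofReal (l ^ 2)) +
          (∫⁻ z in (Metric.ball x (2 * l))ᶜ, f z / edist x z) *
            (2 * V * ENNReal.ofReal (l ^ 3)) := by
        rw [lintegral_mul_const _ hf, lintegral_mul_const _ (by fun_prop)]
    _ ≤ (A * ENNReal.ofReal ((2 * l) ^ (3 - 2 * p))) * (2 * V * ENNReal.ofReal (l ^ 2)) +
          (A * ENNReal.ofReal ((2 * l) ^ (3 - 2 * p - 1) / (1 - (3 - 2 * p)))) *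
            (2 * V * ENNReal.ofReal (l ^ 3)) := by
        gcongr ?_ * _ + ?_ * _
        · exact h _ h2l
        · exact setLIntegral_compl_ball_div_edist_le x hf (by linarith) h2l h
    _ = V * A * ENNReal.ofReal (2 * (2 * l) ^ (3 - 2 * p) * l ^ 2 +
          2 * ((2 * l) ^ (3 - 2 * p - 1) / (1 - (3 - 2 * p))) * l ^ 3) := by
        have h5 : 0 < 1 - (3 - 2 * p) := by linarith
        rw [ENNReal.ofReal_add (by positivity) (by positivity),
          ENNReal.ofReal_mul (by positivity), ENNReal.ofReal_mul (by positivity),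
          ENNReal.ofReal_mul (by positivity), ENNReal.ofReal_mul (by positivity),
          ENNReal.ofReal_ofNat]
        ring
    _ ≤ _ := by
        gcongr
        have e1 : (2 * l) ^ (3 - 2 * p) * l ^ 2 = 2 ^ (3 - 2 * p) * l ^ (5 - 2 * p) := by
          rw [Real.mul_rpow (by norm_num) hl.le, mul_assoc, ← Real.rpow_natCast l 2,
            ← Real.rpow_add hl]
          congr 2
          push_cast
          ring
        have e2 : (2 * l) ^ (3 - 2 * p - 1) * l ^ 3 = 2 ^ (2 - 2 * p) * l ^ (5 - 2 * p) := by
          rw [Real.mul_rpow (by norm_num) hl.le, mul_assoc, ← Real.rpow_natCast l 3,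
            ← Real.rpow_add hl]
          congr 2
          · ring
          · push_cast
            ring
        have b1 : (2 : ℝ) ^ (3 - 2 * p) ≤ 2 := by
          simpa using Real.rpow_le_rpow_of_exponent_le (x := 2) (by norm_num)
            (show 3 - 2 * p ≤ 1 by linarith)
        have b2 : (2 : ℝ) ^ (2 - 2 * p) ≤ 1 :=
          Real.rpow_le_one_of_one_le_of_nonpos (by norm_num) (by linarith)
        have hL : 0 < l ^ (5 - 2 * p) := by positivity
        calc _ = (2 * 2 ^ (3 - 2 * p) + 2 ^ (2 - 2 * p) / (p - 1)) * l ^ (5 - 2 * p) := by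
              rw [mul_assoc, e1, mul_assoc, div_mul_eq_mul_div, e2,
                show 1 - (3 - 2 * p) = 2 * (p - 1) by ring]
              field_simp
          _ ≤ _ := by
              gcongr
              linarith

theorem setLIntegral_ball_rpow_le_morreyNorm {p : ℝ} (hp : 1 < p) (w : E3 → ℝ≥0∞) (x : E3)
    {t : ℝ} (ht : 0 < t) :
    ∫⁻ y in Metric.ball x t, w y ^ p ≤
      2 * morreyNorm p w ^ p * ENNReal.ofReal (t ^ (3 - 2 * p)) := by
  have hp0 : 0 < p := by linarith
  have hsub : Metric.ball x t ⊆ cube3 x (2 * t) := by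
    intro y hy i
    have h1 : |y i - x i| ≤ dist y x := by
      rw [dist_eq_norm]
      simpa using PiLp.norm_apply_le (y - x) i
    have h2 : dist y x < t := hy
    linarith
  have hr : 0 < 2 * t := by positivity
  set r := 2 * t with hrt
  set I := ∫⁻ y in cube3 x r, w y ^ p with hI
  have hρ0 : ENNReal.ofReal (r ^ 3) ≠ 0 := by simp; positivity
  have hρt : ENNReal.ofReal (r ^ 3) ≠ ⊤ := ENNReal.ofReal_ne_top
  have h1 : ENNReal.ofReal (r ^ 3) ^ ((2 : ℝ) / 3) *
      ((ENNReal.ofReal (r ^ 3))⁻¹ * I) ^ ((1 : ℝ) / p) ≤ morreyNorm p w :=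
    le_iSup_of_le x (le_iSup_of_le r (le_iSup_of_le hr le_rfl))
  have h2 := ENNReal.rpow_le_rpow h1 hp0.le
  rw [ENNReal.mul_rpow_of_nonneg _ _ hp0.le, ← ENNReal.rpow_mul, ← ENNReal.rpow_mul,
    one_div_mul_cancel hp0.ne', ENNReal.rpow_one, ← mul_assoc, ← ENNReal.rpow_neg_one,
    ← ENNReal.rpow_add _ _ hρ0 hρt] at h2
  have h3 : I ≤ morreyNorm p w ^ p * ENNReal.ofReal (r ^ (3 - 2 * p)) := by
    calc I = (ENNReal.ofReal (r ^ 3) ^ (2 / 3 * p + -1) * I) *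
          ENNReal.ofReal (r ^ 3) ^ (-(2 / 3 * p + -1)) := by
          rw [mul_right_comm, ← ENNReal.rpow_add _ _ hρ0 hρt]
          simp
      _ ≤ morreyNorm p w ^ p * ENNReal.ofReal (r ^ 3) ^ (-(2 / 3 * p + -1)) := by gcongr
      _ = _ := by
          rw [ENNReal.ofReal_rpow_of_pos (by positivity), ← Real.rpow_natCast r 3,
            ← Real.rpow_mul hr.le]
          congr 3
          push_cast
          ring
  calc _ ≤ I := lintegral_mono_set hsub
    _ ≤ _ := h3
    _ ≤ morreyNorm p w ^ p * ENNReal.ofReal (2 * t ^ (3 - 2 * p)) := by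
        gcongr
        rw [hrt, Real.mul_rpow (by norm_num) ht.le]
        gcongr
        simpa using Real.rpow_le_rpow_of_exponent_le (x := 2) (by norm_num)
            (show 3 - 2 * p ≤ 1 by linarith)
    _ = _ := by
        rw [ENNReal.ofReal_mul (by norm_num), ENNReal.ofReal_ofNat]
        ring

theorem lintegral_mul_rpow_mul_le {α : Type*} [MeasurableSpace α] {μ : Measure α}
    {u v k : α → ℝ≥0∞} (hu : Measurable u) (hv : Measurable v) (hk : Measurable k) {p : ℝ}
    (hp : 1 < p) :
    ∫⁻ y, u y * v y ^ (1 - 1 / p) * k y ∂μ ≤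
      (∫⁻ y, u y ^ p * k y ∂μ) ^ (1 / p) * (∫⁻ y, v y * k y ∂μ) ^ (1 - 1 / p) := by
  have hp0 : 0 < p := by linarith
  have h1 : 0 ≤ 1 / p := by positivity
  have h2 : 0 ≤ 1 - 1 / p := sub_nonneg.2 ((div_le_one hp0).2 hp.le)
  refine le_trans (le_of_eq (lintegral_congr fun y => ?_))
    (ENNReal.lintegral_mul_norm_pow_le (f := fun y => u y ^ p * k y) (g := fun y => v y * k y)
      (Measurable.aemeasurable (by fun_prop)) (Measurable.aemeasurable (by fun_prop)) h1 h2
      (by ring))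
  rw [ENNReal.mul_rpow_of_nonneg _ _ h1, ENNReal.mul_rpow_of_nonneg _ _ h2, ← ENNReal.rpow_mul,
    mul_one_div_cancel hp0.ne', ENNReal.rpow_one]
  nth_rewrite 1 [← ENNReal.rpow_one (k y)]
  rw [show (1 : ℝ) = 1 / p + (1 - 1 / p) by ring, ENNReal.rpow_add_of_nonneg _ _ h1 h2]
  rw [show 1 / p + (1 - 1 / p) = 1 by ring]
  ring

/-- The weighted Schur-test bound: `φ = (I₂ (w ^ p)) ^ (1 - 1 / p)` is, up to a constant, a
supersolution for the operator `φ ↦ I₂ (w φ)`. -/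
theorem I2_mul_rpow_le {p : ℝ} (hp : 1 < p) : ∃ D : ℝ≥0∞, D ≠ ⊤ ∧
    ∀ w : E3 → ℝ≥0∞, Measurable w → ∀ A : ℝ≥0∞, A ≠ 0 → A ≠ ⊤ →
    (∀ x t, 0 < t →
      ∫⁻ y in Metric.ball x t, w y ^ p ≤ A * ENNReal.ofReal (t ^ (3 - 2 * p))) →
    ∀ x : E3, I2 (fun y => w y ^ p) x ≠ 0 → I2 (fun y => w y ^ p) x ≠ ⊤ →
      I2 (fun y => w y * I2 (fun y => w y ^ p) y ^ (1 - 1 / p)) x ≤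
        D * A ^ (1 / p) * I2 (fun y => w y ^ p) x ^ (1 - 1 / p) := by
  set V := volume (Metric.ball (0 : E3) 1) with hV
  have hVt : V ≠ ⊤ := measure_ball_lt_top.ne
  have hp0 : 0 < p := by linarith
  have hp1 : 0 < p - 1 := by linarith
  have h1 : 0 ≤ 1 / p := by positivity
  have h2 : 0 ≤ 1 - 1 / p := sub_nonneg.2 ((div_le_one hp0).2 hp.le)
  have hτ : 0 < 2 * (p - 1) ^ 2 / p := by positivity
  refine ⟨(4 * V) ^ (1 - 1 / p) + (V * ENNReal.ofReal (4 + 1 / (p - 1))) ^ (1 - 1 / p) *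
    ENNReal.ofReal (1 / (2 * (p - 1) ^ 2 / p)), ?_, ?_⟩
  · refine ENNReal.add_ne_top.2 ⟨ENNReal.rpow_ne_top_of_nonneg h2 ?_, ENNReal.mul_ne_top
      (ENNReal.rpow_ne_top_of_nonneg h2 ?_) ENNReal.ofReal_ne_top⟩
    · exact ENNReal.mul_ne_top (by simp) hVt
    · exact ENNReal.mul_ne_top hVt ENNReal.ofReal_ne_top
  intro w hw A hA0 hAt hball x hG0 hGt
  have hf : Measurable fun y => w y ^ p := by fun_prop
  set G := I2 (fun y => w y ^ p) with hG
  have hGm : Measurable G := measurable_I2 hf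
  obtain ⟨a, ha, rfl⟩ : ∃ a : ℝ, 0 < a ∧ A = ENNReal.ofReal a :=
    ⟨A.toReal, ENNReal.toReal_pos hA0 hAt, (ENNReal.ofReal_toReal hAt).symm⟩
  obtain ⟨γ, hγ, hGγ⟩ : ∃ γ : ℝ, 0 < γ ∧ G x = ENNReal.ofReal γ :=
    ⟨(G x).toReal, ENNReal.toReal_pos hG0 hGt, (ENNReal.ofReal_toReal hGt).symm⟩
  set δ : ℝ := (a / γ) ^ (1 / (2 * p - 2)) with hδdef
  have h2p : 2 * p - 2 ≠ 0 := by linarith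
  have haγ : 0 < a / γ := by positivity
  have hδ : 0 < δ := by positivity
  have hnear : ∫⁻ y in Metric.ball x δ, w y * G y ^ (1 - 1 / p) / edist x y ≤
      (4 * V) ^ (1 - 1 / p) * ENNReal.ofReal (a ^ (1 / p) * γ ^ (1 - 1 / p)) := by
    calc _ ≤ (∫⁻ y in Metric.ball x δ, w y ^ p * (edist x y)⁻¹) ^ (1 / p) *
          (∫⁻ y in Metric.ball x δ, G y * (edist x y)⁻¹) ^ (1 - 1 / p) :=
          lintegral_mul_rpow_mul_le hw hGm (by fun_prop) hp
      _ ≤ (G x) ^ (1 / p) * (4 * V * ENNReal.ofReal (δ ^ 2) * G x) ^ (1 - 1 / p) := by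
          gcongr
          · exact setLIntegral_le_lintegral _ _
          · exact setLIntegral_ball_I2_div_edist_le x hf hδ
      _ = (4 * V) ^ (1 - 1 / p) *
            ENNReal.ofReal (γ ^ (1 / p) * (δ ^ 2 * γ) ^ (1 - 1 / p)) := by
          rw [mul_assoc, ENNReal.mul_rpow_of_nonneg _ _ h2, hGγ,
            ← ENNReal.ofReal_mul (by positivity), ENNReal.ofReal_rpow_of_pos (by positivity),
            ENNReal.ofReal_rpow_of_pos (by positivity), mul_left_comm,
            ← ENNReal.ofReal_mul (by positivity)]
      _ = _ := by
          congr 2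
          rw [Real.mul_rpow (by positivity) hγ.le, ← Real.rpow_natCast δ 2, hδdef,
            ← Real.rpow_mul haγ.le, ← Real.rpow_mul haγ.le,
            show 1 / (2 * p - 2) * ((2 : ℕ) : ℝ) * (1 - 1 / p) = 1 / p by
              push_cast; field_simp, Real.div_rpow ha.le hγ.le]
          have : 0 < γ ^ (1 / p) := by positivity
          field_simp
  have hfar : ∫⁻ y in (Metric.ball x δ)ᶜ, w y * G y ^ (1 - 1 / p) / edist x y ≤
      (V * ENNReal.ofReal (4 + 1 / (p - 1))) ^ (1 - 1 / p) *
        ENNReal.ofReal (1 / (2 * (p - 1) ^ 2 / p)) *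
          ENNReal.ofReal (a ^ (1 / p) * γ ^ (1 - 1 / p)) := by
    have hb : ∀ t, 0 < t → ∫⁻ y in Metric.ball x t, w y * G y ^ (1 - 1 / p) ≤
        ((V * ENNReal.ofReal (4 + 1 / (p - 1))) ^ (1 - 1 / p) * ENNReal.ofReal a) *
          ENNReal.ofReal (t ^ (5 - 2 * p - 2 / p)) := by
      intro t ht
      calc _ ≤ (∫⁻ y in Metric.ball x t, w y ^ p) ^ (1 / p) *
            (∫⁻ y in Metric.ball x t, G y) ^ (1 - 1 / p) := by
            simpa only [mul_one] using lintegral_mul_rpow_mul_le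
              (μ := volume.restrict (Metric.ball x t)) hw hGm
              (measurable_const (a := (1 : ℝ≥0∞))) hp
        _ ≤ (ENNReal.ofReal a * ENNReal.ofReal (t ^ (3 - 2 * p))) ^ (1 / p) *
            (V * ENNReal.ofReal a *
              ENNReal.ofReal ((4 + 1 / (p - 1)) * t ^ (5 - 2 * p))) ^ (1 - 1 / p) := by
            gcongr
            · exact hball x t ht
            · exact setLIntegral_ball_I2_le x hf hp (hball x) ht
        _ = (V * ENNReal.ofReal (4 + 1 / (p - 1))) ^ (1 - 1 / p) *
            ENNReal.ofReal ((a * t ^ (3 - 2 * p)) ^ (1 / p) *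
              (a * t ^ (5 - 2 * p)) ^ (1 - 1 / p)) := by
            have e : V * ENNReal.ofReal a *
                ENNReal.ofReal ((4 + 1 / (p - 1)) * t ^ (5 - 2 * p)) =
                (V * ENNReal.ofReal (4 + 1 / (p - 1))) *
                  ENNReal.ofReal (a * t ^ (5 - 2 * p)) := by
              rw [ENNReal.ofReal_mul (by positivity), ENNReal.ofReal_mul ha.le]
              ring
            rw [e, ENNReal.mul_rpow_of_nonneg _ _ h2, ← ENNReal.ofReal_mul ha.le,
              ENNReal.ofReal_rpow_of_pos (by positivity),
              ENNReal.ofReal_rpow_of_pos (by positivity), mul_left_comm,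
              ← ENNReal.ofReal_mul (by positivity)]
        _ = _ := by
            rw [mul_assoc, ← ENNReal.ofReal_mul ha.le]
            congr 2
            rw [Real.mul_rpow ha.le (by positivity), Real.mul_rpow ha.le (by positivity),
              mul_mul_mul_comm, ← Real.rpow_add ha, ← Real.rpow_mul ht.le, ← Real.rpow_mul ht.le,
              ← Real.rpow_add ht, show 1 / p + (1 - 1 / p) = 1 by ring, Real.rpow_one]
            congr 2
            field_simp
            ring
    have hτ' : 1 - (5 - 2 * p - 2 / p) = 2 * (p - 1) ^ 2 / p := by
      field_simp
      ring
    refine (setLIntegral_compl_ball_div_edist_le x (by fun_prop) (by linarith) hδ hb).trans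
      (le_of_eq ?_)
    rw [mul_assoc, mul_assoc, ← ENNReal.ofReal_mul ha.le, ← ENNReal.ofReal_mul (by positivity),
      hτ']
    congr 2
    have hδτ : δ ^ (5 - 2 * p - 2 / p - 1) = a ^ (1 / p) / γ ^ (1 / p) / (a / γ) := by
      rw [hδdef, ← Real.rpow_mul haγ.le, ← Real.div_rpow ha.le hγ.le,
        ← Real.rpow_sub_one haγ.ne']
      congr 1
      field_simp
      ring
    rw [hδτ, Real.rpow_sub hγ, Real.rpow_one]
    field_simp
  rw [I2, ← lintegral_add_compl _ (Metric.isOpen_ball (x := x) (ε := δ)).measurableSet, hGγ,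
    ENNReal.ofReal_rpow_of_pos ha, ENNReal.ofReal_rpow_of_pos hγ, mul_assoc,
    ← ENNReal.ofReal_mul (by positivity), add_mul]
  exact add_le_add hnear hfar

theorem ae_eq_zero_of_I2_eq_zero {f : E3 → ℝ≥0∞} (hf : Measurable f) {x : E3}
    (h : I2 f x = 0) : f =ᵐ[volume] 0 := by
  rw [I2, lintegral_eq_zero_iff (by fun_prop)] at h
  filter_upwards [h] with y hy
  rcases ENNReal.div_eq_zero_iff.1 hy with h | h
  · exact h
  · exact absurd h (edist_ne_top _ _)

theorem ae_I2_lt_top {f : E3 → ℝ≥0∞} (hf : Measurable f) {p : ℝ} (hp : 1 < p) {A : ℝ≥0∞}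
    (hA : A ≠ ⊤)
    (h : ∀ t, 0 < t →
      ∫⁻ y in Metric.ball 0 t, f y ≤ A * ENNReal.ofReal (t ^ (3 - 2 * p))) :
    ∀ᵐ y, I2 f y < ⊤ := by
  have h1 : ∀ n : ℕ, ∀ᵐ y, y ∈ Metric.ball (0 : E3) (n + 1) → I2 f y < ⊤ := by
    intro n
    rw [← ae_restrict_iff' Metric.isOpen_ball.measurableSet]
    refine ae_lt_top (measurable_I2 hf) (ne_top_of_le_ne_top ?_
      (setLIntegral_ball_I2_le 0 hf hp h (by positivity)))
    exact ENNReal.mul_ne_top (ENNReal.mul_ne_top measure_ball_lt_top.ne hA)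
      ENNReal.ofReal_ne_top
  filter_upwards [ae_all_iff.2 h1] with y hy
  obtain ⟨n, hn⟩ := exists_nat_gt (dist y 0)
  exact hy n (Metric.mem_ball.2 (by linarith))

/-- Schur's test for a symmetric kernel. -/
theorem lintegral_lintegral_div_edist_le {μ : Measure E3} [SFinite μ] {w φ : E3 → ℝ≥0∞}
    (hw : Measurable w) (hφ : Measurable φ) {K : ℝ≥0∞}
    (h0 : ∀ᵐ x ∂μ, φ x ≠ 0) (ht : ∀ᵐ x ∂μ, φ x ≠ ⊤)
    (h : ∀ᵐ x ∂μ, ∫⁻ y, w y * φ y / edist x y ∂μ ≤ K * φ x) :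
    ∫⁻ x, ∫⁻ y, w x * w y / edist x y ∂μ ∂μ ≤ 2 * K * ∫⁻ x, w x ∂μ := by
  have hT : ∫⁻ x, ∫⁻ y, w x * (φ x)⁻¹ * (w y * φ y / edist x y) ∂μ ∂μ ≤ K * ∫⁻ x, w x ∂μ := by
    rw [← lintegral_const_mul _ hw]
    apply lintegral_mono_ae
    filter_upwards [h0, ht, h] with x h0x htx hx
    rw [lintegral_const_mul _ (by fun_prop)]
    calc _ ≤ w x * (φ x)⁻¹ * (K * φ x) := by gcongr
      _ = K * w x * ((φ x)⁻¹ * φ x) := by ring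
      _ = _ := by rw [ENNReal.inv_mul_cancel h0x htx, mul_one]
  calc ∫⁻ x, ∫⁻ y, w x * w y / edist x y ∂μ ∂μ
      ≤ ∫⁻ x, ∫⁻ y, (w x * (φ x)⁻¹ * (w y * φ y / edist x y) +
          w y * (φ y)⁻¹ * (w x * φ x / edist y x)) ∂μ ∂μ := by
        apply lintegral_mono_ae
        filter_upwards [h0, ht] with x h0x htx
        apply lintegral_mono_ae
        filter_upwards [h0, ht] with y h0y hty
        have key : 1 ≤ (φ x)⁻¹ * φ y + (φ y)⁻¹ * φ x := by
          rcases le_total (φ x) (φ y) with hxy | hxy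
          · exact le_add_right ((ENNReal.inv_mul_cancel h0x htx).ge.trans (by gcongr))
          · exact le_add_left ((ENNReal.inv_mul_cancel h0y hty).ge.trans (by gcongr))
        calc w x * w y / edist x y ≤
              ((φ x)⁻¹ * φ y + (φ y)⁻¹ * φ x) * (w x * w y / edist x y) :=
              le_mul_of_one_le_left' key
          _ = _ := by
              rw [edist_comm y x]
              simp only [div_eq_mul_inv]
              ring
    _ = (∫⁻ x, ∫⁻ y, w x * (φ x)⁻¹ * (w y * φ y / edist x y) ∂μ ∂μ) +
          ∫⁻ x, ∫⁻ y, w y * (φ y)⁻¹ * (w x * φ x / edist y x) ∂μ ∂μ := by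
        rw [← lintegral_add_left]
        · refine lintegral_congr fun x => ?_
          rw [lintegral_add_left (by fun_prop)]
        · exact Measurable.lintegral_prod_right'
            (f := fun q : E3 × E3 => w q.1 * (φ q.1)⁻¹ * (w q.2 * φ q.2 / edist q.1 q.2))
            (by fun_prop)
    _ ≤ K * ∫⁻ x, w x ∂μ + K * ∫⁻ x, w x ∂μ := by
        gcongr
        rw [lintegral_lintegral_swap (Measurable.aemeasurable (by fun_prop))]
        exact hT
    _ = _ := by ring

/-- The Morrey class `M^p(ℝ³)`, `1 < p ≤ 3/2`, embeds into the class `F`. -/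
theorem stmt8 :
    ∀ p : ℝ, 1 < p → p ≤ 3/2 →
      ∃ C : ℝ≥0, 0 < C ∧ ∀ w : E3 → ℝ≥0∞, Measurable w → morreyNorm p w < ⊤ →
        ksNorm w ≤ C * morreyNorm p w := by
  intro p hp _
  obtain ⟨D, hDt, hD⟩ := I2_mul_rpow_le hp
  have hp0 : 0 < p := by linarith
  have h1 : 0 ≤ 1 / p := by positivity
  have h2 : 0 < 1 - 1 / p := sub_pos.2 ((div_lt_one hp0).2 hp)
  have hKt : 2 * (D * 2 ^ (1 / p)) ≠ ⊤ := ENNReal.mul_ne_top (by simp)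
    (ENNReal.mul_ne_top hDt (ENNReal.rpow_ne_top_of_nonneg h1 (by simp)))
  refine ⟨(2 * (D * 2 ^ (1 / p))).toNNReal + 1, by positivity, fun w hw hM => ?_⟩
  set M := morreyNorm p w with hMdef
  have hball : ∀ x t, 0 < t →
      ∫⁻ y in Metric.ball x t, w y ^ p ≤ 2 * M ^ p * ENNReal.ofReal (t ^ (3 - 2 * p)) :=
    fun x t ht => setLIntegral_ball_rpow_le_morreyNorm hp w x ht
  have hf : Measurable fun y => w y ^ p := by fun_prop
  have hAt : 2 * M ^ p ≠ ⊤ :=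
    ENNReal.mul_ne_top (by simp) (ENNReal.rpow_ne_top_of_nonneg hp0.le hM.ne)
  refine iSup_le fun z => iSup_le fun r => iSup_le fun _ => ?_
  by_cases hw0 : w =ᵐ[volume] 0
  · have : ∫⁻ x in cube3 z r, ∫⁻ y in cube3 z r, w x * w y / edist x y = 0 := by
      refine (lintegral_congr_ae ?_).trans lintegral_zero
      filter_upwards [ae_restrict_of_ae hw0] with x hx
      simp [hx]
    simp [ksRatio, this]
  have hG0 : ∀ x, I2 (fun y => w y ^ p) x ≠ 0 := by
    intro x hx
    apply hw0
    filter_upwards [ae_eq_zero_of_I2_eq_zero hf hx] with y hy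
    exact (ENNReal.rpow_eq_zero_iff_of_pos hp0).1 hy
  have hA0 : 2 * M ^ p ≠ 0 := by
    intro h0
    refine hG0 0 (le_antisymm ?_ zero_le)
    refine (lintegral_div_edist_le 0 hf).trans (le_of_eq ?_)
    refine (setLIntegral_congr_fun measurableSet_Ioi fun t ht => ?_).trans lintegral_zero
    have := hball 0 t ht
    rw [h0, zero_mul] at this
    simp [le_antisymm this zero_le]
  have hGt := ae_I2_lt_top hf hp hAt (hball 0)
  have hφ : Measurable fun y => I2 (fun y => w y ^ p) y ^ (1 - 1 / p) :=
    (measurable_I2 hf).pow_const _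
  have hmain : ∫⁻ x in cube3 z r, ∫⁻ y in cube3 z r, w x * w y / edist x y ≤
      2 * (D * (2 * M ^ p) ^ (1 / p)) * ∫⁻ x in cube3 z r, w x := by
    refine lintegral_lintegral_div_edist_le hw hφ (ae_of_all _ fun x => ?_)
      (ae_restrict_of_ae ?_) (ae_restrict_of_ae ?_)
    · rw [Ne, ENNReal.rpow_eq_zero_iff_of_pos h2]
      exact hG0 x
    · filter_upwards [hGt] with x hx
      exact ENNReal.rpow_ne_top_of_nonneg h2.le hx.ne
    · filter_upwards [hGt] with x hx
      exact (setLIntegral_le_lintegral _ _).trans (hD w hw _ hA0 hAt hball x (hG0 x) hx.ne)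
  rw [ENNReal.mul_rpow_of_nonneg _ _ h1, ← ENNReal.rpow_mul, mul_one_div_cancel hp0.ne',
    ENNReal.rpow_one] at hmain
  calc ksRatio w z r ≤ (∫⁻ x in cube3 z r, w x)⁻¹ *
        (2 * (D * (2 ^ (1 / p) * M)) * ∫⁻ x in cube3 z r, w x) := by
        unfold ksRatio
        gcongr
    _ = 2 * (D * 2 ^ (1 / p)) * M *
          ((∫⁻ x in cube3 z r, w x)⁻¹ * ∫⁻ x in cube3 z r, w x) := by ring
    _ ≤ 2 * (D * 2 ^ (1 / p)) * M * 1 := by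
        gcongr
        exact ENNReal.inv_mul_le_one _
    _ ≤ _ := by
        rw [mul_one, ENNReal.coe_add, ENNReal.coe_toNNReal hKt]
        gcongr
        exact le_self_add
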